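/- Let 0 < α < β < ∞. For Lebesgue-almost every ω ∈ [0,1], the sequence n^{1/α} x_n(ω) converges, as n → ∞, to (1/2)(α p₁)^{-1/α}. -/

import Mathlib

open MeasureTheory Filter Set Topology

noncomputable section

/-- The Liverani–Saussol–Vaienti map `T_a` on `[0,1]`. -/
def lsv (a x : ℝ) : ℝ := if x ≤ 1 / 2 then x * (1 + (2 : ℝ) ^ a * x ^ a) else 2 * x - 1

/-- Random parameter selection: `α` on `[0,p₁)`, `β` on `[p₁,1]`. -/
def alphaOf (α β p₁ ω : ℝ) : ℝ := if ω < p₁ then α else β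

/-- The noise dynamics `φ` on `[0,1]`. -/
def phiMap (p₁ ω : ℝ) : ℝ := if ω < p₁ then ω / p₁ else (ω - p₁) / (1 - p₁)

/-- The skew product `S(x,ω) = (T_{α(ω)} x, φ ω)`. -/
def skewLSV (α β p₁ : ℝ) (p : ℝ × ℝ) : ℝ × ℝ :=
  (lsv (alphaOf α β p₁ p.2) p.1, phiMap p₁ p.2)

/-- The base of inducing, `Δ₀ = (1/2,1] × [0,1]`. -/
def Δ0 : Set (ℝ × ℝ) := Ioc (1 / 2 : ℝ) 1 ×ˢ Icc (0 : ℝ) 1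

lemma one_sub_one_add_rpow_neg_le {c u : ℝ} (hc : 0 < c) (hu : 0 ≤ u) :
    1 - (1 + u) ^ (-c) ≤ c * u := by
  have hpos : 0 < 1 + u := by linarith
  rw [Real.rpow_def_of_pos hpos]
  have h1 := Real.add_one_le_exp (Real.log (1 + u) * -c)
  have h2 : Real.log (1 + u) ≤ u := by
    have := Real.log_le_sub_one_of_pos hpos
    linarith
  nlinarith

lemma le_one_sub_one_add_rpow_neg {c u : ℝ} (hc : 0 < c) (hu : 0 ≤ u) :
    c * u / (1 + (1 + c) * u) ≤ 1 - (1 + u) ^ (-c) := by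
  have hpos : 0 < 1 + u := by linarith
  have hcu : 0 ≤ c * u := by positivity
  have hlog : u / (1 + u) ≤ Real.log (1 + u) := by
    have := Real.one_sub_inv_le_log_of_pos hpos
    have h : 1 - (1 + u)⁻¹ = u / (1 + u) := by field_simp; ring
    linarith
  have hden : 0 < 1 + (1 + c) * u := by nlinarith
  have hle : (1 + (1 + c) * u) / (1 + u) ≤ (1 + u) ^ c := by
    rw [Real.rpow_def_of_pos hpos]
    have h1 := Real.add_one_le_exp (Real.log (1 + u) * c)
    have h2 : (1 + (1 + c) * u) / (1 + u) = u / (1 + u) * c + 1 := by field_simp; ring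
    nlinarith
  have hinv : (1 + u) ^ (-c) ≤ (1 + u) / (1 + (1 + c) * u) := by
    rw [Real.rpow_neg hpos.le, ← inv_div]
    exact inv_anti₀ (by positivity) hle
  have h3 : c * u / (1 + (1 + c) * u) = 1 - (1 + u) / (1 + (1 + c) * u) := by
    field_simp; ring
  linarith

lemma rpow_neg_sub_rpow_neg {y a c : ℝ} (hy : 0 < y) :
    y ^ (-c) - (y * (1 + y ^ a)) ^ (-c) = y ^ (-c) * (1 - (1 + y ^ a) ^ (-c)) := by
  rw [Real.mul_rpow hy.le (by positivity)]
  ring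

/-- Each inverse branch step increases `y ^ (-β)` by a definite amount. -/
lemma rpow_neg_increment_lower_bound {y a β : ℝ} (hy : 0 < y) (hy1 : y ≤ 1) (hβ : 0 < β)
    (haβ : a ≤ β) :
    β / (2 + β) ≤ y ^ (-β) - (y * (1 + y ^ a)) ^ (-β) := by
  rw [rpow_neg_sub_rpow_neg hy]
  have hu : 0 < y ^ β := by positivity
  have hu1 : y ^ β ≤ 1 := Real.rpow_le_one hy.le hy1 hβ.le
  have hua : y ^ β ≤ y ^ a := Real.rpow_le_rpow_of_exponent_ge hy hy1 haβ
  have h1 := le_one_sub_one_add_rpow_neg hβ hu.le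
  have h2 : (1 + y ^ a) ^ (-β) ≤ (1 + y ^ β) ^ (-β) :=
    Real.rpow_le_rpow_of_nonpos (by positivity) (by linarith) (by linarith)
  calc β / (2 + β) ≤ β / (1 + (1 + β) * y ^ β) := by
        refine div_le_div_of_nonneg_left hβ.le (by positivity) ?_
        nlinarith
    _ = y ^ (-β) * (β * y ^ β / (1 + (1 + β) * y ^ β)) := by
        rw [Real.rpow_neg hy.le]; field_simp
    _ ≤ _ := by gcongr; linarith

lemma abs_rpow_neg_increment_sub_le {y α : ℝ} (hy : 0 < y) (hα : 0 < α) :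
    |y ^ (-α) - (y * (1 + y ^ α)) ^ (-α) - α| ≤ α * (1 + α) * y ^ α := by
  rw [rpow_neg_sub_rpow_neg hy]
  have hu : 0 < y ^ α := by positivity
  have h1 := le_one_sub_one_add_rpow_neg hα hu.le
  have h2 := one_sub_one_add_rpow_neg_le hα hu.le
  rw [Real.rpow_neg hy.le]
  set u := y ^ α
  have h3 : u⁻¹ * (1 - (1 + u) ^ (-α)) ≤ α := by
    rw [inv_mul_le_iff₀ hu]; linarith
  have h4 : α - α * (1 + α) * u ≤ u⁻¹ * (1 - (1 + u) ^ (-α)) := by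
    rw [le_inv_mul_iff₀ hu]
    refine le_trans ?_ h1
    rw [le_div_iff₀ (by positivity)]
    have : 0 ≤ α * (1 + α) ^ 2 * u ^ 3 := by positivity
    nlinarith
  rw [abs_le]
  have : 0 ≤ α * (1 + α) * u := by positivity
  constructor <;> linarith

lemma abs_rpow_neg_increment_le {y a α : ℝ} (hy : 0 < y) (hα : 0 < α) :
    |y ^ (-α) - (y * (1 + y ^ a)) ^ (-α)| ≤ α * y ^ (a - α) := by
  rw [rpow_neg_sub_rpow_neg hy]
  have hu : 0 < y ^ a := by positivity
  have h2 := one_sub_one_add_rpow_neg_le hα hu.le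
  have h1 : (1 + y ^ a) ^ (-α) ≤ 1 :=
    Real.rpow_le_one_of_one_le_of_nonpos (by linarith) (by linarith)
  rw [abs_of_nonneg (mul_nonneg (by positivity) (by linarith)), sub_eq_add_neg a,
    Real.rpow_add hy]
  have : 0 < y ^ (-α) := by positivity
  nlinarith

lemma lsv_of_mem_Ioc {a x : ℝ} (hx : x ∈ Ioc (0 : ℝ) (1 / 2)) :
    2 * lsv a x = 2 * x * (1 + (2 * x) ^ a) := by
  rw [lsv, if_pos hx.2, Real.mul_rpow (by norm_num) hx.1.le]
  ring

/-- The indicator of the event `ω < p` that the first parameter is selected. -/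
def branchIndicator (p : ℝ) : ℝ → ℝ := (Iio p).indicator fun _ => 1

section Deterministic

variable {α β p₁ : ℝ} {X : ℕ → ℝ → ℝ}

lemma two_mul_mem_Ioc (hX1 : ∀ ω, X 1 ω = 1 / 2)
    (hX : ∀ n, 2 ≤ n → ∀ ω, X n ω ∈ Ioc (0 : ℝ) (1 / 2) ∧
      lsv (alphaOf α β p₁ ω) (X n ω) = X (n - 1) (phiMap p₁ ω)) (n : ℕ) (ω : ℝ) :
    0 < 2 * X (n + 1) ω ∧ 2 * X (n + 1) ω ≤ 1 := by
  rcases Nat.eq_zero_or_pos n with rfl | hn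
  · rw [hX1]; norm_num
  · obtain ⟨⟨h0, h1⟩, -⟩ := hX (n + 1) (by omega) ω
    constructor <;> linarith

lemma two_mul_step
    (hX : ∀ n, 2 ≤ n → ∀ ω, X n ω ∈ Ioc (0 : ℝ) (1 / 2) ∧
      lsv (alphaOf α β p₁ ω) (X n ω) = X (n - 1) (phiMap p₁ ω)) (n : ℕ) (ω : ℝ) :
    2 * X (n + 1) (phiMap p₁ ω) =
      2 * X (n + 2) ω * (1 + (2 * X (n + 2) ω) ^ alphaOf α β p₁ ω) := by
  obtain ⟨h0, h1⟩ := hX (n + 2) (by omega) ω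
  rw [← lsv_of_mem_Ioc h0, h1]
  rfl

lemma rpow_two_mul_le (hα : 0 < α) (hαβ : α < β) (hX1 : ∀ ω, X 1 ω = 1 / 2)
    (hX : ∀ n, 2 ≤ n → ∀ ω, X n ω ∈ Ioc (0 : ℝ) (1 / 2) ∧
      lsv (alphaOf α β p₁ ω) (X n ω) = X (n - 1) (phiMap p₁ ω)) (n : ℕ) (ω : ℝ) :
    2 * X (n + 1) ω ≤ (1 + β / (2 + β) * n) ^ (-(1 / β)) := by
  have hβ : 0 < β := hα.trans hαβ
  have key : 1 + β / (2 + β) * n ≤ (2 * X (n + 1) ω) ^ (-β) := by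
    induction n generalizing ω with
    | zero => simp [hX1]
    | succ n ih =>
      obtain ⟨h0, h1⟩ := two_mul_mem_Ioc hX1 hX (n + 1) ω
      have ha : alphaOf α β p₁ ω ≤ β := by
        unfold alphaOf; split_ifs <;> linarith
      have h2 := rpow_neg_increment_lower_bound h0 h1 hβ ha
      rw [← two_mul_step hX n ω] at h2
      have h3 := ih (phiMap p₁ ω)
      push_cast
      linarith
  obtain ⟨h0, -⟩ := two_mul_mem_Ioc hX1 hX n ω
  have h1 : (0 : ℝ) < 1 + β / (2 + β) * n := by positivity
  have h2 := Real.rpow_le_rpow_of_nonpos (z := -(1 / β)) h1 key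
    (neg_nonpos.2 (by positivity))
  rwa [← Real.rpow_mul h0.le, show -β * -(1 / β) = 1 by field_simp, Real.rpow_one] at h2

lemma exists_uniform_increment_error (hα : 0 < α) (hαβ : α < β) (hX1 : ∀ ω, X 1 ω = 1 / 2)
    (hX : ∀ n, 2 ≤ n → ∀ ω, X n ω ∈ Ioc (0 : ℝ) (1 / 2) ∧
      lsv (alphaOf α β p₁ ω) (X n ω) = X (n - 1) (phiMap p₁ ω)) :
    ∃ δ : ℕ → ℝ, Tendsto δ atTop (𝓝 0) ∧ ∀ n ω,
      |(2 * X (n + 2) ω) ^ (-α) - (2 * X (n + 1) (phiMap p₁ ω)) ^ (-α)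
        - α * branchIndicator p₁ ω| ≤ δ n := by
  have hβ : 0 < β := hα.trans hαβ
  set r : ℕ → ℝ := fun n => (1 + β / (2 + β) * ((n + 1 : ℕ) : ℝ)) ^ (-(1 / β)) with hr
  have hr0 : Tendsto r atTop (𝓝 0) := by
    refine (tendsto_rpow_neg_atTop (by positivity : 0 < 1 / β)).comp ?_
    refine tendsto_atTop_add_const_left _ _ ?_
    exact ((tendsto_natCast_atTop_atTop (R := ℝ)).comp (tendsto_add_atTop_nat 1)).const_mul_atTop
      (by positivity)
  have hpow : ∀ c : ℝ, 0 < c → Tendsto (fun n => r n ^ c) atTop (𝓝 0) := fun c hc => by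
    simpa [Real.zero_rpow hc.ne'] using hr0.rpow_const (p := c) (Or.inr hc.le)
  refine ⟨fun n => α * (1 + α) * r n ^ α + α * r n ^ (β - α), ?_, fun n ω => ?_⟩
  · simpa using ((hpow α hα).const_mul (α * (1 + α))).add
      ((hpow (β - α) (by linarith)).const_mul α)
  · obtain ⟨h0, -⟩ := two_mul_mem_Ioc hX1 hX (n + 1) ω
    have hle : 2 * X (n + 2) ω ≤ r n := rpow_two_mul_le hα hαβ hX1 hX (n + 1) ω
    have hrn : 0 < r n := h0.trans_le hle
    have hA : α * (1 + α) * (2 * X (n + 2) ω) ^ α ≤ α * (1 + α) * r n ^ α := by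
      gcongr
    have hB : α * (2 * X (n + 2) ω) ^ (β - α) ≤ α * r n ^ (β - α) := by
      have : 0 < β - α := by linarith
      gcongr
    have hA' : 0 ≤ α * (1 + α) * r n ^ α := by positivity
    have hB' : 0 ≤ α * r n ^ (β - α) := by positivity
    rw [two_mul_step hX n ω]
    by_cases hω : ω < p₁
    · have := abs_rpow_neg_increment_sub_le h0 hα
      simp only [branchIndicator, alphaOf, indicator, mem_Iio, hω, if_true, mul_one]
      linarith
    · have := abs_rpow_neg_increment_le (a := β) h0 hα
      simp only [branchIndicator, alphaOf, indicator, mem_Iio, hω, if_false, mul_zero, sub_zero]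
      linarith

lemma abs_rpow_neg_sub_birkhoffSum_le (hX1 : ∀ ω, X 1 ω = 1 / 2) {δ : ℕ → ℝ}
    (hδ : ∀ n ω, |(2 * X (n + 2) ω) ^ (-α) - (2 * X (n + 1) (phiMap p₁ ω)) ^ (-α)
        - α * branchIndicator p₁ ω| ≤ δ n) (n : ℕ) (ω : ℝ) :
    |(2 * X (n + 1) ω) ^ (-α) - 1 - α * birkhoffSum (phiMap p₁) (branchIndicator p₁) n ω|
      ≤ ∑ k ∈ Finset.range n, δ k := by
  induction n generalizing ω with
  | zero => simp [hX1]
  | succ n ih =>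
    rw [birkhoffSum_succ', Finset.sum_range_succ]
    have h1 := abs_le.1 (ih (phiMap p₁ ω))
    have h2 := abs_le.1 (hδ n ω)
    rw [abs_le]
    constructor <;> linarith [h1.1, h1.2, h2.1, h2.2]

end Deterministic

section StrongLaw

open ProbabilityTheory

variable {p₁ : ℝ}

lemma measurable_phiMap : Measurable (phiMap p₁) := by
  unfold phiMap
  exact Measurable.ite measurableSet_Iio (by fun_prop) (by fun_prop)

lemma measurable_branchIndicator : Measurable (branchIndicator p₁) :=
  measurable_const.indicator measurableSet_Iio

lemma volume_Iio_inter_phiMap_preimage (hp₁ : 0 < p₁) (hp₁' : p₁ < 1) {B : Set ℝ}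
    (hB : MeasurableSet B) :
    volume.restrict (Ico (0 : ℝ) 1) (Iio p₁ ∩ phiMap p₁ ⁻¹' B) =
      ENNReal.ofReal p₁ * volume.restrict (Ico (0 : ℝ) 1) B := by
  rw [Measure.restrict_apply (measurableSet_Iio.inter (measurable_phiMap hB)),
    Measure.restrict_apply hB]
  have h : Iio p₁ ∩ phiMap p₁ ⁻¹' B ∩ Ico 0 1 = (p₁⁻¹ * ·) ⁻¹' (B ∩ Ico 0 1) := by
    ext ω
    simp only [mem_inter_iff, mem_Iio, mem_preimage, mem_Ico, phiMap]
    have e1 : p₁⁻¹ * ω = ω / p₁ := by ring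
    have e2 : 0 ≤ ω / p₁ ↔ 0 ≤ ω := by rw [le_div_iff₀ hp₁, zero_mul]
    have e3 : ω / p₁ < 1 ↔ ω < p₁ := div_lt_one hp₁
    rw [e1, e2, e3]
    constructor
    · rintro ⟨⟨h1, h2⟩, h3, -⟩
      rw [if_pos h1] at h2
      exact ⟨h2, h3, h1⟩
    · rintro ⟨h2, h3, h1⟩
      rw [if_pos h1]
      exact ⟨⟨h1, h2⟩, h3, h1.trans hp₁'⟩
  rw [h, Real.volume_preimage_mul_left (inv_ne_zero hp₁.ne'), inv_inv, abs_of_pos hp₁]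

lemma volume_Iio_compl_inter_phiMap_preimage (hp₁ : 0 < p₁) (hp₁' : p₁ < 1) {B : Set ℝ}
    (hB : MeasurableSet B) :
    volume.restrict (Ico (0 : ℝ) 1) ((Iio p₁)ᶜ ∩ phiMap p₁ ⁻¹' B) =
      ENNReal.ofReal (1 - p₁) * volume.restrict (Ico (0 : ℝ) 1) B := by
  rw [Measure.restrict_apply (measurableSet_Iio.compl.inter (measurable_phiMap hB)),
    Measure.restrict_apply hB]
  have hq : 0 < 1 - p₁ := by linarith
  have h : (Iio p₁)ᶜ ∩ phiMap p₁ ⁻¹' B ∩ Ico 0 1 =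
      (fun ω => ω + -p₁) ⁻¹' (((1 - p₁)⁻¹ * ·) ⁻¹' (B ∩ Ico 0 1)) := by
    ext ω
    simp only [mem_inter_iff, mem_Iio, mem_preimage, mem_Ico, mem_compl_iff, phiMap]
    have e1 : (1 - p₁)⁻¹ * (ω + -p₁) = (ω - p₁) / (1 - p₁) := by ring
    have e2 : 0 ≤ (ω - p₁) / (1 - p₁) ↔ ¬ ω < p₁ := by
      rw [le_div_iff₀ hq, zero_mul, sub_nonneg, not_lt]
    have e3 : (ω - p₁) / (1 - p₁) < 1 ↔ ω < 1 := by
      rw [div_lt_one hq, sub_lt_sub_iff_right]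
    rw [e1, e2, e3]
    constructor
    · rintro ⟨⟨h1, h2⟩, -, h3⟩
      rw [if_neg h1] at h2
      exact ⟨h2, h1, h3⟩
    · rintro ⟨h2, h1, h3⟩
      rw [if_neg h1]
      exact ⟨⟨h1, h2⟩, hp₁.le.trans (not_lt.1 h1), h3⟩
  rw [h, measure_preimage_add_right, Real.volume_preimage_mul_left (inv_ne_zero hq.ne'), inv_inv,
    abs_of_pos hq]

lemma measurePreserving_phiMap (hp₁ : 0 < p₁) (hp₁' : p₁ < 1) :
    MeasurePreserving (phiMap p₁) (volume.restrict (Ico (0 : ℝ) 1))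
      (volume.restrict (Ico (0 : ℝ) 1)) := by
  refine ⟨measurable_phiMap, Measure.ext fun B hB => ?_⟩
  rw [Measure.map_apply measurable_phiMap hB,
    ← measure_inter_add_sdiff (phiMap p₁ ⁻¹' B) (measurableSet_Iio (a := p₁)), sdiff_eq,
    inter_comm _ (Iio p₁), inter_comm _ (Iio p₁)ᶜ, volume_Iio_inter_phiMap_preimage hp₁ hp₁' hB,
    volume_Iio_compl_inter_phiMap_preimage hp₁ hp₁' hB, ← add_mul,
    ← ENNReal.ofReal_add hp₁.le (by linarith)]
  simp

lemma isProbabilityMeasure_restrict_Ico :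
    IsProbabilityMeasure (volume.restrict (Ico (0 : ℝ) 1)) := ⟨by simp⟩

lemma indepFun_branchIndicator_phiMap (hp₁ : 0 < p₁) (hp₁' : p₁ < 1) :
    IndepFun (branchIndicator p₁) (phiMap p₁) (volume.restrict (Ico (0 : ℝ) 1)) := by
  have := isProbabilityMeasure_restrict_Ico
  have hA : volume.restrict (Ico (0 : ℝ) 1) (Iio p₁) = ENNReal.ofReal p₁ := by
    simpa using volume_Iio_inter_phiMap_preimage hp₁ hp₁' MeasurableSet.univ
  have hA' : volume.restrict (Ico (0 : ℝ) 1) (Iio p₁)ᶜ = ENNReal.ofReal (1 - p₁) := by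
    have := volume_Iio_compl_inter_phiMap_preimage hp₁ hp₁' MeasurableSet.univ
    rw [preimage_univ, inter_univ, measure_univ, mul_one] at this
    exact this
  rw [indepFun_iff_measure_inter_preimage_eq_mul]
  intro s t _ ht
  have hφ := (measurePreserving_phiMap hp₁ hp₁').measure_preimage ht.nullMeasurableSet
  have hs := indicator_const_preimage (Iio p₁) s (1 : ℝ)
  change branchIndicator p₁ ⁻¹' s ∈ _ at hs
  rcases hs with hs | hs | hs | hs
  · rw [hs, univ_inter, measure_univ, one_mul]
  · rw [hs, volume_Iio_inter_phiMap_preimage hp₁ hp₁' ht, hA, hφ]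
  · rw [hs, volume_Iio_compl_inter_phiMap_preimage hp₁ hp₁' ht, hA', hφ]
  · rw [mem_singleton_iff.1 hs, empty_inter, measure_empty, zero_mul]

lemma indepFun_branchIndicator_iterate (hp₁ : 0 < p₁) (hp₁' : p₁ < 1) {i j : ℕ} (hij : i < j) :
    IndepFun (branchIndicator p₁ ∘ (phiMap p₁)^[i]) (branchIndicator p₁ ∘ (phiMap p₁)^[j])
      (volume.restrict (Ico (0 : ℝ) 1)) := by
  obtain ⟨k, rfl⟩ := Nat.exists_eq_add_of_lt hij
  have h : IndepFun (branchIndicator p₁) (branchIndicator p₁ ∘ (phiMap p₁)^[k] ∘ phiMap p₁)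
      (volume.restrict (Ico (0 : ℝ) 1)) :=
    (indepFun_branchIndicator_phiMap hp₁ hp₁').comp measurable_id
      (measurable_branchIndicator.comp (measurable_phiMap.iterate k))
  have hφ := (measurePreserving_phiMap hp₁ hp₁').iterate i
  have hm : Measurable (branchIndicator p₁ ∘ (phiMap p₁)^[k] ∘ phiMap p₁) :=
    measurable_branchIndicator.comp ((measurable_phiMap.iterate k).comp measurable_phiMap)
  have hit : branchIndicator p₁ ∘ (phiMap p₁)^[i + k + 1] =
      (branchIndicator p₁ ∘ (phiMap p₁)^[k] ∘ phiMap p₁) ∘ (phiMap p₁)^[i] := by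
    rw [show i + k + 1 = (k + 1) + i by ring, Function.iterate_add, Function.iterate_succ]
    rfl
  rw [hit]
  rw [indepFun_iff_measure_inter_preimage_eq_mul] at h ⊢
  intro s t hs ht
  rw [preimage_comp, preimage_comp, ← preimage_inter,
    hφ.measure_preimage ((measurable_branchIndicator hs).inter (hm ht)).nullMeasurableSet,
    hφ.measure_preimage (measurable_branchIndicator hs).nullMeasurableSet,
    hφ.measure_preimage (hm ht).nullMeasurableSet]
  exact h s t hs ht

/-- Strong law of large numbers for the frequency of visits to the first branch. -/
lemma ae_tendsto_birkhoffSum_branchIndicator (hp₁ : 0 < p₁) (hp₁' : p₁ < 1) :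
    ∀ᵐ ω ∂(volume.restrict (Icc (0 : ℝ) 1)),
      Tendsto (fun n : ℕ => birkhoffSum (phiMap p₁) (branchIndicator p₁) n ω / n) atTop
        (𝓝 p₁) := by
  have := isProbabilityMeasure_restrict_Ico
  rw [← Measure.restrict_congr_set (Ico_ae_eq_Icc (μ := volume) (a := (0 : ℝ)) (b := 1))]
  have hφ := measurePreserving_phiMap hp₁ hp₁'
  have hint : Integrable (branchIndicator p₁) (volume.restrict (Ico (0 : ℝ) 1)) :=
    (integrable_const 1).indicator measurableSet_Iio
  have hmean : ∫ ω in Ico (0 : ℝ) 1, branchIndicator p₁ ω = p₁ := by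
    have hA : volume.restrict (Ico (0 : ℝ) 1) (Iio p₁) = ENNReal.ofReal p₁ := by
      simpa using volume_Iio_inter_phiMap_preimage hp₁ hp₁' MeasurableSet.univ
    rw [branchIndicator, integral_indicator_const _ measurableSet_Iio, measureReal_def, hA,
      ENNReal.toReal_ofReal hp₁.le, smul_eq_mul, mul_one]
  have hlaw := strong_law_ae_real (fun i => branchIndicator p₁ ∘ (phiMap p₁)^[i]) hint
    (fun i j hij => by
      rcases hij.lt_or_gt with h | h
      · exact indepFun_branchIndicator_iterate hp₁ hp₁' h
      · exact (indepFun_branchIndicator_iterate hp₁ hp₁' h).symm)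
    (fun i =>
      { aemeasurable_fst :=
          (measurable_branchIndicator.comp (measurable_phiMap.iterate i)).aemeasurable
        aemeasurable_snd := measurable_branchIndicator.aemeasurable
        map_eq := by
          rw [← Measure.map_map measurable_branchIndicator (measurable_phiMap.iterate i),
            (hφ.iterate i).map_eq]
          rfl })
  filter_upwards [hlaw] with ω hω
  have hmean' : ∫ ω in Ico (0 : ℝ) 1, (branchIndicator p₁ ∘ (phiMap p₁)^[0]) ω = p₁ := hmean
  rw [hmean'] at hω
  exact hω

end StrongLaw

/-- If `z` follows `α * b` up to a sum of vanishing errors, their averages have the same limit. -/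
lemma tendsto_div_of_abs_sub_le_sum {z b δ : ℕ → ℝ} {α p : ℝ} (hδ : Tendsto δ atTop (𝓝 0))
    (hz : ∀ n, |z n - 1 - α * b n| ≤ ∑ k ∈ Finset.range n, δ k)
    (hb : Tendsto (fun n : ℕ => b n / n) atTop (𝓝 p)) :
    Tendsto (fun n : ℕ => z n / ((n + 1 : ℕ) : ℝ)) atTop (𝓝 (α * p)) := by
  have herr : Tendsto (fun n : ℕ => (z n - 1 - α * b n) / n) atTop (𝓝 0) := by
    refine squeeze_zero_norm (fun n => ?_) hδ.cesaro
    rw [norm_div, Real.norm_eq_abs, RCLike.norm_natCast, div_eq_inv_mul]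
    exact mul_le_mul_of_nonneg_left (hz n) (by positivity)
  have hone : Tendsto (fun n : ℕ => (1 : ℝ) / n) atTop (𝓝 0) := tendsto_one_div_atTop_nhds_zero_nat
  have hratio : Tendsto (fun n : ℕ => (n : ℝ) / ((n + 1 : ℕ) : ℝ)) atTop (𝓝 1) := by
    simpa using tendsto_natCast_div_add_atTop (1 : ℝ)
  have hsum := ((herr.add hone).add (hb.const_mul α)).mul hratio
  simp only [zero_add, mul_one] at hsum
  refine hsum.congr' ?_
  filter_upwards [eventually_gt_atTop 0] with n hn
  have : (n : ℝ) ≠ 0 := by positivity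
  push_cast
  field_simp
  ring

/-- Theorem 1.1, a.e. part: for `0 < α < β < ∞`, for Lebesgue-a.e.
`ω ∈ [0,1]`, `n^{1/α} x_n(ω) → (1/2) (α p₁)^{-1/α}`. -/
theorem quenched_asymptotics_ae (α β p₁ : ℝ) (hα : 0 < α) (hαβ : α < β)
    (hp₁ : 0 < p₁) (hp₁' : p₁ < 1)
    (X : ℕ → ℝ → ℝ) (hX1 : ∀ ω, X 1 ω = 1 / 2)
    (hX : ∀ n, 2 ≤ n → ∀ ω, X n ω ∈ Ioc (0 : ℝ) (1 / 2) ∧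
      lsv (alphaOf α β p₁ ω) (X n ω) = X (n - 1) (phiMap p₁ ω)) :
    ∀ᵐ ω ∂(volume.restrict (Icc (0 : ℝ) 1)),
      Tendsto (fun n : ℕ => (n : ℝ) ^ (1 / α) * X n ω) atTop
        (𝓝 ((1 / 2 : ℝ) * (α * p₁) ^ (-(1 / α)))) := by
  obtain ⟨δ, hδ0, hδ⟩ := exists_uniform_increment_error hα hαβ hX1 hX
  filter_upwards [ae_tendsto_birkhoffSum_branchIndicator hp₁ hp₁'] with ω hω
  have hlim := tendsto_div_of_abs_sub_le_sum hδ0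
    (fun n => abs_rpow_neg_sub_birkhoffSum_le hX1 hδ n ω) hω
  have hpow := (hlim.rpow_const (p := -(1 / α)) (Or.inl (by positivity))).const_mul (1 / 2)
  rw [← tendsto_add_atTop_iff_nat 1]
  refine hpow.congr fun n => ?_
  obtain ⟨h0, -⟩ := two_mul_mem_Ioc hX1 hX n ω
  rw [Real.div_rpow (by positivity) (by positivity), ← Real.rpow_mul h0.le,
    show -α * -(1 / α) = 1 by field_simp, Real.rpow_one, Real.rpow_neg (by positivity),
    div_inv_eq_mul]
  ring
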